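/- arXiv:1806.04565 — 2 statements merged into one kernel-verified Lean document; each statement's English description precedes it below -/
import Mathlib

section
/- If (a,b,c) is an admissible triple of nonnegative integers, then θ(a,b,c) is a nonzero Laurent polynomial whose v-degree equals a+b+c+ab+bc+ca−(a²+b²+c²)/2 and whose leading coefficient equals (−1)^{(a+b+c)/2}; that is, θ(a,b,c) = (−1)^{(a+b+c)/2} v^{a+b+c+ab+bc+ca−(a²+b²+c²)/2} + (terms of lower v-degree). -/
/-!
Common definitions for formalizing "Colored Jones polynomials without tails"
(Lee--van der Veen).  We work in the field `RatFunc ℚ` of rational functions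
in one variable `V` over `ℚ`.
-/

open Polynomial

noncomputable section

namespace CJP

/-- The variable `v` of the field `ℚ(v)`. -/
noncomputable def V : RatFunc ℚ := RatFunc.X

/-- The quantum integer `[k] = ∑_{j=0}^{k-1} v^(2(k-1)-4j)`, so that
`(v^2 - v^(-2)) * [k] = v^(2k) - v^(-2k)`; it is `0` for `k ≤ 0`. -/
noncomputable def qint (k : ℤ) : RatFunc ℚ :=
  ∑ j ∈ Finset.range k.toNat, V ^ (2 * (k - 1) - 4 * (j : ℤ))

/-- The quantum factorial `[k]! = [1][2]⋯[k]` for `k ≥ 0`, and `0` for `k < 0`. -/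
noncomputable def qfact (k : ℤ) : RatFunc ℚ :=
  if k < 0 then 0 else ∏ j ∈ Finset.range k.toNat, qint ((j : ℤ) + 1)

/-- `O^k = (-1)^k [k+1]`. -/
noncomputable def qO (k : ℤ) : RatFunc ℚ := (-1 : RatFunc ℚ) ^ k * qint (k + 1)

/-- The two-part quantum multinomial (quantum binomial) `[n; k, n-k]`. -/
noncomputable def qbinom (n k : ℤ) : RatFunc ℚ := qfact n / (qfact k * qfact (n - k))

/-- `θ(a,b,c) = O^((a+b+c)/2) ⬝ [(a+b+c)/2; (-a+b+c)/2, (a-b+c)/2, (a+b-c)/2]`. -/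
noncomputable def qtheta (a b c : ℤ) : RatFunc ℚ :=
  qO ((a + b + c) / 2) * (qfact ((a + b + c) / 2) /
    (qfact ((-a + b + c) / 2) * qfact ((a - b + c) / 2) * qfact ((a + b - c) / 2)))

/-- The normalized 6j-symbol
`Δ(a,b,c,α,β,γ) = ∑_z (O^z / O^((a+b+c)/2)) [z; (a+b+c)/2, z-(a+b+c)/2] ⋯`.
Only finitely many `z` give a nonzero summand, so the `finsum` is well defined. -/
noncomputable def qdelta (a b c α β γ : ℤ) : RatFunc ℚ :=
  ∑ᶠ z : ℤ, (qO z / qO ((a + b + c) / 2)) * qbinom z ((a + b + c) / 2) *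
    qbinom ((-a + b + c) / 2) (z - (a + β + γ) / 2) *
    qbinom ((a - b + c) / 2) (z - (α + b + γ) / 2) *
    qbinom ((a + b - c) / 2) (z - (α + β + c) / 2)

/-- The framing factor `f(a) = i^(-a) v^(-a(a+2)/2)`, written for even `a`
(where it equals `(-1)^(a/2) v^(-a(a+2)/2)`, an element of `ℤ[v,v⁻¹]`). -/
noncomputable def qf (a : ℤ) : RatFunc ℚ :=
  (-1 : RatFunc ℚ) ^ (a / 2) * V ^ (-(a * (a + 2)) / 2)

/-- `f(a)^e = i^(-a e) v^(-a(a+2)e/2)` for `a*e` even, where it equals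
`(-1)^(a e / 2) v^(-a(a+2)e/2)`. -/
noncomputable def qfpow (a e : ℤ) : RatFunc ℚ :=
  (-1 : RatFunc ℚ) ^ (a * e / 2) * V ^ (-(a * (a + 2) * e) / 2)

/-- `x ∈ ℚ(v)` is a Laurent polynomial with integer coefficients: for some `m`,
`x * v^m` is (the image in `ℚ(v)` of) a polynomial with integer coefficients. -/
def IsIntLaurent (x : RatFunc ℚ) : Prop :=
  ∃ (p : Polynomial ℤ) (m : ℕ),
    x * V ^ m = algebraMap (Polynomial ℚ) (RatFunc ℚ) (p.map (Int.castRingHom ℚ))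

/-- The leading coefficient of a rational function : the ratio of the leading
coefficients of its numerator and denominator. -/
noncomputable def leadC (x : RatFunc ℚ) : ℚ := x.num.leadingCoeff / x.denom.leadingCoeff

/-- Admissibility of a triple of nonnegative integers. -/
def Admissible (a b c : ℤ) : Prop := 2 ∣ (a + b + c) ∧ |a - b| ≤ c ∧ c ≤ a + b

/-- Membership of an integer lattice point in the polytope `nP`, where
`P = {(a,b,c,d) ∈ [0,1]⁴ : |a-b| ≤ c ≤ a+b}`. -/
def inP (n a b c d : ℤ) : Prop :=
  0 ≤ a ∧ a ≤ n ∧ 0 ≤ b ∧ b ≤ n ∧ 0 ≤ c ∧ c ≤ n ∧ 0 ≤ d ∧ d ≤ n ∧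
    |a - b| ≤ c ∧ c ≤ a + b

/-- The summand `T_{a,b,c,d}` of the state sum for the colored Jones polynomial
`J_{C(r,s,t,u),n+1}`. -/
noncomputable def T (r s t u n a b c d : ℤ) : RatFunc ℚ :=
  (qdelta (2*a) (2*b) (2*c) n n n) ^ 2 * qdelta (2*b) n n (2*d) n n *
    qO (2*a) * qO (2*b) * qO (2*c) * qO (2*d) *
    qf (2*a) ^ r * qf (2*b) ^ s * qf (2*c) ^ t * qf (2*d) ^ (-u) *
    qtheta (2*a) (2*b) (2*c) /
    (qtheta (2*a) n n * qtheta (2*b) n n * qtheta (2*c) n n * qtheta (2*d) n n)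

/-- The state sum `J(r,s,t,u; n+1)`, i.e. the `(n+1)`-colored Jones polynomial of the
`0`-framed Montesinos knot `C(r,s,t,u)`:
`f(n)^(-2(r-s+t-u)-2r-2s-2t+2u) ⬝ ∑_{(a,b,c,d) ∈ nP ∩ ℤ⁴} T_{a,b,c,d}`. -/
noncomputable def J (r s t u n : ℤ) : RatFunc ℚ :=
  qfpow n (-2*(r - s + t - u) - 2*r - 2*s - 2*t + 2*u) *
    ∑ a ∈ Finset.Icc 0 n, ∑ b ∈ Finset.Icc 0 n, ∑ c ∈ Finset.Icc 0 n,
      ∑ d ∈ Finset.Icc 0 n,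
        if |a - b| ≤ c ∧ c ≤ a + b then T r s t u n a b c d else 0

end CJP

namespace CJP

lemma V_ne_zero : V ≠ 0 := RatFunc.X_ne_zero

/-! ### Leading coefficients and degrees of rational functions -/

lemma leadC_mul (x y : RatFunc ℚ) : leadC (x * y) = leadC x * leadC y := by
  have h := congrArg Polynomial.leadingCoeff (RatFunc.num_denom_mul x y)
  simp only [Polynomial.leadingCoeff_mul] at h
  have hx := Polynomial.leadingCoeff_ne_zero.mpr x.denom_ne_zero
  have hy := Polynomial.leadingCoeff_ne_zero.mpr y.denom_ne_zero
  have hxy := Polynomial.leadingCoeff_ne_zero.mpr (x * y).denom_ne_zero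
  unfold leadC
  field_simp
  linear_combination h

/-- The leading coefficient as a multiplicative homomorphism. -/
noncomputable def leadCHom : RatFunc ℚ →*₀ ℚ where
  toFun := leadC
  map_zero' := by simp [leadC]
  map_one' := by simp [leadC]
  map_mul' := leadC_mul

lemma leadC_algebraMap (p : ℚ[X]) : leadC (algebraMap ℚ[X] (RatFunc ℚ) p) = p.leadingCoeff := by
  simp [leadC]

lemma leadC_V : leadC V = 1 := by simp [leadC, V]

lemma leadC_zpow (x : RatFunc ℚ) (n : ℤ) : leadC (x ^ n) = leadC x ^ n :=
  map_zpow₀ leadCHom x n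

lemma leadC_div (x y : RatFunc ℚ) : leadC (x / y) = leadC x / leadC y :=
  map_div₀ leadCHom x y

lemma intDegree_div {x y : RatFunc ℚ} (hx : x ≠ 0) (hy : y ≠ 0) :
    (x / y).intDegree = x.intDegree - y.intDegree := by
  have h := RatFunc.intDegree_mul (div_ne_zero hx hy) hy
  rw [div_mul_cancel₀ _ hy] at h
  omega

lemma intDegree_V_zpow (n : ℤ) : (V ^ n).intDegree = n := by
  have hpow (k : ℕ) : (V ^ k).intDegree = k := by
    have h : V ^ k = algebraMap ℚ[X] (RatFunc ℚ) (X ^ k) := by simp [V]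
    rw [h, RatFunc.intDegree_polynomial, natDegree_X_pow]
  obtain ⟨k, rfl | rfl⟩ := n.eq_nat_or_neg
  · rw [zpow_natCast, hpow]
  · rw [zpow_neg, zpow_natCast, RatFunc.intDegree_inv, hpow]

lemma intDegree_neg_one_zpow (n : ℤ) : ((-1 : RatFunc ℚ) ^ n).intDegree = 0 := by
  rcases n.even_or_odd with h | h
  · simp [h.neg_one_zpow]
  · simp [h.neg_one_zpow, RatFunc.intDegree_neg]

/-! ### Quantum integers -/

lemma V_pow_sub_one_ne_zero {n : ℕ} (hn : 0 < n) : V ^ n - 1 ≠ 0 := by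
  have h : V ^ n - 1 = algebraMap ℚ[X] (RatFunc ℚ) (X ^ n - C 1) := by simp [V]
  rw [h]
  exact RatFunc.algebraMap_ne_zero (X_pow_sub_C_ne_zero hn 1)

lemma intDegree_V_pow_sub_one {n : ℕ} : (V ^ n - 1).intDegree = n := by
  have h : V ^ n - 1 = algebraMap ℚ[X] (RatFunc ℚ) (X ^ n - C 1) := by simp [V]
  rw [h, RatFunc.intDegree_polynomial, natDegree_X_pow_sub_C]

lemma leadC_V_pow_sub_one {n : ℕ} (hn : 0 < n) : leadC (V ^ n - 1) = 1 := by
  have h : V ^ n - 1 = algebraMap ℚ[X] (RatFunc ℚ) (X ^ n - C 1) := by simp [V]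
  rw [h, leadC_algebraMap, leadingCoeff_X_pow_sub_C hn]

lemma qint_mul (n : ℕ) :
    qint n * (V ^ 4 - 1) = (V ^ (4 * n) - 1) * V ^ (2 - 2 * (n : ℤ)) := by
  have hV := V_ne_zero
  have key (m : ℕ) (e : ℤ) : (∑ j ∈ Finset.range m, V ^ (e - 4 * (j : ℤ))) * (V ^ 4 - 1) =
      (V ^ (4 * m) - 1) * V ^ (e + 4 - 4 * (m : ℤ)) := by
    induction m with
    | zero => simp
    | succ m ih =>
      rw [Finset.sum_range_succ, add_mul, ih]
      have h1 : V ^ (e + 4 - 4 * (m : ℤ)) = V ^ (e - 4 * (m : ℤ)) * V ^ 4 := by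
        rw [← zpow_natCast V 4, ← zpow_add₀ hV]; congr 1; push_cast; ring
      have h2 : V ^ (e + 4 - 4 * ((m + 1 : ℕ) : ℤ)) = V ^ (e - 4 * (m : ℤ)) := by
        congr 1; push_cast; ring
      rw [h1, h2]
      ring
  rw [qint, Int.toNat_natCast, key]
  congr 2
  ring

lemma qint_ne_zero {n : ℕ} (hn : 0 < n) : qint n ≠ 0 := by
  refine left_ne_zero_of_mul (b := V ^ 4 - 1) ?_
  rw [qint_mul]
  exact mul_ne_zero (V_pow_sub_one_ne_zero (by omega)) (zpow_ne_zero _ V_ne_zero)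

lemma intDegree_qint {n : ℕ} (hn : 0 < n) : (qint n).intDegree = 2 * n - 2 := by
  have h := congrArg RatFunc.intDegree (qint_mul n)
  rw [RatFunc.intDegree_mul (qint_ne_zero hn) (V_pow_sub_one_ne_zero (by norm_num)),
    RatFunc.intDegree_mul (V_pow_sub_one_ne_zero (by omega)) (zpow_ne_zero _ V_ne_zero),
    intDegree_V_pow_sub_one, intDegree_V_pow_sub_one, intDegree_V_zpow] at h
  push_cast at h
  omega

lemma leadC_qint {n : ℕ} (hn : 0 < n) : leadC (qint n) = 1 := by
  have h := congrArg leadC (qint_mul n)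
  rwa [leadC_mul, leadC_mul, leadC_V_pow_sub_one (by norm_num), leadC_V_pow_sub_one (by omega),
    leadC_zpow, leadC_V, one_zpow, mul_one, mul_one] at h

lemma qint_add (m n : ℕ) :
    qint ((m + n : ℕ) : ℤ) = V ^ (2 * (n : ℤ)) * qint m + V ^ (-2 * (m : ℤ)) * qint n := by
  have hV := V_ne_zero
  refine mul_right_cancel₀ (V_pow_sub_one_ne_zero (n := 4) (by norm_num)) ?_
  rw [add_mul, mul_assoc, mul_assoc, qint_mul, qint_mul, qint_mul]
  have hsub (k : ℕ) (e : ℤ) : (V ^ (4 * k) - 1) * V ^ e = V ^ (4 * (k : ℤ) + e) - V ^ e := by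
    rw [zpow_add₀ hV, sub_mul, one_mul]
    norm_cast
  rw [hsub, hsub, hsub, mul_sub, mul_sub, ← zpow_add₀ hV, ← zpow_add₀ hV, ← zpow_add₀ hV,
    ← zpow_add₀ hV]
  push_cast
  ring_nf

/-! ### Quantum factorials -/

lemma qfact_zero : qfact 0 = 1 := by simp [qfact]

lemma qfact_succ (n : ℕ) : qfact ((n + 1 : ℕ) : ℤ) = qfact n * qint ((n + 1 : ℕ) : ℤ) := by
  simp only [qfact, Int.toNat_natCast, Finset.prod_range_succ]
  rw [if_neg (by omega), if_neg (by omega)]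
  push_cast
  rfl

lemma qfact_ne_zero (n : ℕ) : qfact n ≠ 0 := by
  induction n with
  | zero => simp [qfact_zero]
  | succ n ih => rw [qfact_succ]; exact mul_ne_zero ih (qint_ne_zero n.succ_pos)

lemma intDegree_qfact (n : ℕ) : (qfact n).intDegree = n * (n - 1) := by
  induction n with
  | zero => simp [qfact_zero]
  | succ n ih =>
    rw [qfact_succ, RatFunc.intDegree_mul (qfact_ne_zero n) (qint_ne_zero n.succ_pos), ih,
      intDegree_qint n.succ_pos]
    push_cast
    ring

lemma leadC_qfact (n : ℕ) : leadC (qfact n) = 1 := by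
  induction n with
  | zero => simp [qfact_zero, leadC]
  | succ n ih => rw [qfact_succ, leadC_mul, ih, leadC_qint n.succ_pos, mul_one]

/-! ### Integral Laurent polynomials -/

namespace IsIntLaurent

variable {x y : RatFunc ℚ}

lemma mul (hx : IsIntLaurent x) (hy : IsIntLaurent y) : IsIntLaurent (x * y) := by
  obtain ⟨p, m, hp⟩ := hx
  obtain ⟨q, n, hq⟩ := hy
  refine ⟨p * q, m + n, ?_⟩
  rw [Polynomial.map_mul, map_mul, ← hp, ← hq]
  ring

lemma add (hx : IsIntLaurent x) (hy : IsIntLaurent y) : IsIntLaurent (x + y) := by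
  obtain ⟨p, m, hp⟩ := hx
  obtain ⟨q, n, hq⟩ := hy
  refine ⟨p * X ^ n + q * X ^ m, m + n, ?_⟩
  simp only [Polynomial.map_add, Polynomial.map_mul, Polynomial.map_pow, Polynomial.map_X,
    map_add, map_mul, map_pow, RatFunc.algebraMap_X, ← hp, ← hq]
  simp only [V]
  ring

lemma zero : IsIntLaurent 0 := ⟨0, 0, by simp⟩

lemma one : IsIntLaurent 1 := ⟨1, 0, by simp⟩

lemma neg_one_zpow (n : ℤ) : IsIntLaurent ((-1) ^ n) := by
  rcases n.even_or_odd with h | h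
  · rw [h.neg_one_zpow]; exact one
  · rw [h.neg_one_zpow]; exact ⟨-1, 0, by simp⟩

lemma V_zpow (n : ℤ) : IsIntLaurent (V ^ n) := by
  refine ⟨X ^ n.toNat, (-n).toNat, ?_⟩
  have h : V ^ n * V ^ (-n).toNat = V ^ n.toNat := by
    rw [← zpow_natCast V, ← zpow_natCast V, ← zpow_add₀ V_ne_zero]
    congr 1
    omega
  rw [h]
  simp [V]

lemma qint (n : ℤ) : IsIntLaurent (qint n) := by
  unfold CJP.qint
  exact Finset.sum_induction _ IsIntLaurent (fun _ _ => add) zero fun _ _ => V_zpow _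

lemma binomial (m n : ℕ) :
    IsIntLaurent (qfact ((m + n : ℕ) : ℤ) / (qfact m * qfact n)) := by
  induction m generalizing n with
  | zero => simpa [qfact_zero, div_self (qfact_ne_zero n)] using one
  | succ m ihm =>
    induction n with
    | zero =>
      rw [add_zero, Nat.cast_zero, qfact_zero, mul_one, div_self (qfact_ne_zero (m + 1))]
      exact one
    | succ n ihn =>
      have hm := qfact_ne_zero m
      have hn := qfact_ne_zero n
      have hm' := qint_ne_zero m.succ_pos
      have hn' := qint_ne_zero n.succ_pos
      have pascal : qfact ((m + 1 + (n + 1) : ℕ) : ℤ) /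
            (qfact ((m + 1 : ℕ) : ℤ) * qfact ((n + 1 : ℕ) : ℤ)) =
          V ^ (2 * ((n + 1 : ℕ) : ℤ)) *
            (qfact ((m + (n + 1) : ℕ) : ℤ) / (qfact m * qfact ((n + 1 : ℕ) : ℤ))) +
          V ^ (-2 * ((m + 1 : ℕ) : ℤ)) *
            (qfact ((m + 1 + n : ℕ) : ℤ) / (qfact ((m + 1 : ℕ) : ℤ) * qfact n)) := by
        have htop : qfact ((m + 1 + (n + 1) : ℕ) : ℤ) =
            qfact ((m + 1 + n : ℕ) : ℤ) * CJP.qint ((m + 1 + (n + 1) : ℕ) : ℤ) :=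
          qfact_succ (m + 1 + n)
        have hmid : m + (n + 1) = m + 1 + n := by omega
        rw [htop, qint_add, hmid, qfact_succ m, qfact_succ n]
        generalize V ^ (2 * ((n + 1 : ℕ) : ℤ)) = s
        generalize V ^ (-2 * ((m + 1 : ℕ) : ℤ)) = t
        field_simp
      rw [pascal]
      exact ((V_zpow _).mul (ihm _)).add ((V_zpow _).mul ihn)

lemma trinomial (l m n : ℕ) :
    IsIntLaurent (qfact ((l + m + n : ℕ) : ℤ) / (qfact l * qfact m * qfact n)) := by
  have hlm := qfact_ne_zero (l + m)
  have h : qfact ((l + m + n : ℕ) : ℤ) / (qfact l * qfact m * qfact n) =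
      qfact ((l + m + n : ℕ) : ℤ) / (qfact ((l + m : ℕ) : ℤ) * qfact n) *
        (qfact ((l + m : ℕ) : ℤ) / (qfact l * qfact m)) := by
    have hl := qfact_ne_zero l
    have hm := qfact_ne_zero m
    have hn := qfact_ne_zero n
    field_simp
  rw [h]
  exact (binomial _ _).mul (binomial _ _)

end IsIntLaurent

/-! ### The theta graph in terms of its internal colors -/

lemma Admissible.exists_internal {a b c : ℤ} (h : Admissible a b c) :
    ∃ x y z : ℕ, a = y + z ∧ b = x + z ∧ c = x + y := by
  obtain ⟨⟨s, hs⟩, habs, hle⟩ := h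
  rw [abs_le] at habs
  exact ⟨(s - a).toNat, (s - b).toNat, (s - c).toNat, by omega, by omega, by omega⟩

lemma qtheta_internal (x y z : ℕ) :
    qtheta (y + z) (x + z) (x + y) =
      (-1) ^ ((x + y + z : ℕ) : ℤ) * qint ((x + y + z + 1 : ℕ) : ℤ) *
        (qfact ((x + y + z : ℕ) : ℤ) / (qfact x * qfact y * qfact z)) := by
  have hs : ((y + z : ℤ) + (x + z) + (x + y)) / 2 = ((x + y + z : ℕ) : ℤ) := by omega
  have hx : (-(y + z : ℤ) + (x + z) + (x + y)) / 2 = x := by omega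
  have hy : ((y + z : ℤ) - (x + z) + (x + y)) / 2 = y := by omega
  have hz : ((y + z : ℤ) + (x + z) - (x + y)) / 2 = z := by omega
  rw [qtheta, hs, hx, hy, hz, qO]
  norm_cast

end CJP

open CJP in
/-- If `(a,b,c)` is an admissible triple of nonnegative integers,
then `θ(a,b,c)` is a nonzero Laurent polynomial whose `v`-degree equals
`a+b+c+ab+bc+ca-(a²+b²+c²)/2` and whose leading coefficient is `(-1)^((a+b+c)/2)`. -/
theorem theta_degree (a b c : ℤ) (ha : 0 ≤ a) (hb : 0 ≤ b) (hc : 0 ≤ c)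
    (hadm : Admissible a b c) :
    qtheta a b c ≠ 0 ∧ IsIntLaurent (qtheta a b c) ∧
    (qtheta a b c).intDegree =
      a + b + c + a * b + b * c + c * a - (a ^ 2 + b ^ 2 + c ^ 2) / 2 ∧
    leadC (qtheta a b c) = (-1 : ℚ) ^ ((a + b + c) / 2) := by
  obtain ⟨x, y, z, rfl, rfl, rfl⟩ := hadm.exists_internal
  have hs : ((y + z : ℤ) + (x + z) + (x + y)) / 2 = ((x + y + z : ℕ) : ℤ) := by omega
  have hsq : ((y + z : ℤ) ^ 2 + (x + z) ^ 2 + (x + y) ^ 2) / 2 =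
      x ^ 2 + y ^ 2 + z ^ 2 + x * y + y * z + z * x :=
    Int.ediv_eq_of_eq_mul_right two_ne_zero (by ring)
  have hsign : (-1 : RatFunc ℚ) ^ ((x + y + z : ℕ) : ℤ) ≠ 0 := zpow_ne_zero _ (by simp)
  have hqint := qint_ne_zero (x + y + z).succ_pos
  have hO := mul_ne_zero hsign hqint
  have hnum := qfact_ne_zero (x + y + z)
  have hxy := mul_ne_zero (qfact_ne_zero x) (qfact_ne_zero y)
  have hden := mul_ne_zero hxy (qfact_ne_zero z)
  have hmult := div_ne_zero hnum hden
  rw [qtheta_internal, hs, hsq]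
  refine ⟨mul_ne_zero hO hmult, ?_, ?_, ?_⟩
  · exact ((IsIntLaurent.neg_one_zpow _).mul (.qint _)).mul (.trinomial x y z)
  · rw [RatFunc.intDegree_mul hO hmult, RatFunc.intDegree_mul hsign hqint,
      intDegree_neg_one_zpow, intDegree_qint (x + y + z).succ_pos, intDegree_div hnum hden,
      RatFunc.intDegree_mul hxy (qfact_ne_zero z),
      RatFunc.intDegree_mul (qfact_ne_zero x) (qfact_ne_zero y)]
    simp only [intDegree_qfact]
    push_cast
    ring
  · have hneg : leadC (-1) = -1 := by
      rw [show (-1 : RatFunc ℚ) = algebraMap ℚ[X] (RatFunc ℚ) (-1) by simp, leadC_algebraMap]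
      simp
    rw [leadC_mul, leadC_mul, leadC_zpow, hneg, leadC_qint (x + y + z).succ_pos, leadC_div,
      leadC_mul, leadC_mul]
    simp only [leadC_qfact, mul_one, div_one]
end
end

section
/- Let r, t ≥ 3, s ≤ −3 and u ≤ −3 be odd integers and let n ≥ 1. Whenever both indicated lattice points lie in nP ∩ ℤ⁴ and the corresponding summands are nonzero, the v-degree δ of the summands of the state sum satisfies the strict inequalities: δ(a+1,b,c,d) < δ(a,b,c,d), δ(a,b,c+1,d) < δ(a,b,c,d), and δ(a,b,c,d) < δ(a,b,c,d−1). -/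
/-!
Common definitions for formalizing "Colored Jones polynomials without tails"
(Lee--van der Veen).  We work in the field `RatFunc ℚ` of rational functions
in one variable `V` over `ℚ`.
-/

open Polynomial

noncomputable section

namespace CJP

/-- `x` is nonzero of `v`-degree `k`. -/
def HasDeg (x : RatFunc ℚ) (k : ℤ) : Prop := x ≠ 0 ∧ x.intDegree = k

/-- `x` is zero or has `v`-degree less than `k`. -/
def DegLT (x : RatFunc ℚ) (k : ℤ) : Prop := x = 0 ∨ x.intDegree < k

namespace HasDeg

variable {x y : RatFunc ℚ} {k l : ℤ}

lemma one : HasDeg 1 0 := ⟨one_ne_zero, RatFunc.intDegree_one⟩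

lemma mul (hx : HasDeg x k) (hy : HasDeg y l) : HasDeg (x * y) (k + l) :=
  ⟨mul_ne_zero hx.1 hy.1, by rw [RatFunc.intDegree_mul hx.1 hy.1, hx.2, hy.2]⟩

lemma inv (hx : HasDeg x k) : HasDeg x⁻¹ (-k) :=
  ⟨inv_ne_zero hx.1, by rw [RatFunc.intDegree_inv, hx.2]⟩

lemma div (hx : HasDeg x k) (hy : HasDeg y l) : HasDeg (x / y) (k - l) := by
  simpa only [div_eq_mul_inv, sub_eq_add_neg] using hx.mul hy.inv

lemma neg (hx : HasDeg x k) : HasDeg (-x) k :=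
  ⟨neg_ne_zero.2 hx.1, by rw [RatFunc.intDegree_neg, hx.2]⟩

lemma pow (hx : HasDeg x k) (m : ℕ) : HasDeg (x ^ m) (m * k) := by
  induction m with
  | zero => simpa using one
  | succ m ih =>
    have h := ih.mul hx
    rw [← pow_succ] at h
    convert h using 1
    push_cast
    ring

lemma zpow (hx : HasDeg x k) (m : ℤ) : HasDeg (x ^ m) (m * k) := by
  cases m with
  | ofNat m => simpa using hx.pow m
  | negSucc m =>
    rw [zpow_negSucc]
    convert (hx.pow (m + 1)).inv using 1
    rw [Int.negSucc_eq]
    push_cast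
    ring

lemma congr (hx : HasDeg x k) (h : k = l) : HasDeg x l := h ▸ hx

lemma degLT (hx : HasDeg x k) (h : k < l) : DegLT x l := Or.inr (hx.2.trans_lt h)

lemma add_degLT (hx : HasDeg x k) (hy : DegLT y k) : HasDeg (x + y) k := by
  rcases eq_or_ne y 0 with rfl | hy0
  · simpa using hx
  have hy' : y.intDegree < k := hy.resolve_left hy0
  have hne : x + y ≠ 0 := by
    intro h
    have h' := hx.2
    rw [eq_neg_of_add_eq_zero_left h, RatFunc.intDegree_neg] at h'
    omega
  refine ⟨hne, ?_⟩
  have h1 := RatFunc.intDegree_add_le hy0 hne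
  have h2 : (x + y + -y).intDegree ≤ max (x + y).intDegree (-y).intDegree :=
    RatFunc.intDegree_add_le (neg_ne_zero.2 hy0) (by simpa using hx.1)
  rw [add_neg_cancel_right, RatFunc.intDegree_neg] at h2
  have h3 := hx.2
  omega

end HasDeg

lemma DegLT.add {x y : RatFunc ℚ} {k : ℤ} (hx : DegLT x k) (hy : DegLT y k) :
    DegLT (x + y) k := by
  by_cases h0 : x + y = 0
  · exact Or.inl h0
  rcases eq_or_ne y 0 with rfl | hy0
  · simpa using hx
  rcases eq_or_ne x 0 with rfl | hx0
  · simpa using hy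
  have h := RatFunc.intDegree_add_le hy0 h0
  have hx' := hx.resolve_left hx0
  have hy' := hy.resolve_left hy0
  exact Or.inr (by omega)

lemma DegLT.sum {ι : Type*} {s : Finset ι} {f : ι → RatFunc ℚ} {k : ℤ}
    (h : ∀ i ∈ s, DegLT (f i) k) : DegLT (∑ i ∈ s, f i) k :=
  Finset.sum_induction f (DegLT · k) (fun _ _ => DegLT.add) (Or.inl rfl) h

/-- A sum with a term of strictly largest degree has the degree of that term. -/
lemma HasDeg.sum {ι : Type*} {s : Finset ι} {f : ι → RatFunc ℚ} {k : ℤ} {i : ι} (hi : i ∈ s)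
    (hf : HasDeg (f i) k) (h : ∀ j ∈ s, j ≠ i → DegLT (f j) k) :
    HasDeg (∑ j ∈ s, f j) k := by
  classical
  rw [← Finset.add_sum_erase s f hi]
  exact hf.add_degLT (DegLT.sum fun j hj => h j (Finset.mem_of_mem_erase hj)
    (Finset.ne_of_mem_erase hj))

lemma hasDeg_V_zpow (m : ℤ) : HasDeg (V ^ m) m :=
  (HasDeg.zpow ⟨RatFunc.X_ne_zero, RatFunc.intDegree_X⟩ m).congr (mul_one m)

lemma hasDeg_neg_one_zpow (m : ℤ) : HasDeg ((-1 : RatFunc ℚ) ^ m) 0 :=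
  (HasDeg.one.neg.zpow m).congr (mul_zero m)

lemma hasDeg_qint {k : ℤ} (hk : 1 ≤ k) : HasDeg (qint k) (2 * (k - 1)) := by
  refine HasDeg.sum (i := 0) (Finset.mem_range.2 (by omega))
    ((hasDeg_V_zpow _).congr (by simp)) fun j _ hj => (hasDeg_V_zpow _).degLT ?_
  omega

lemma hasDeg_qO {k : ℤ} (hk : 0 ≤ k) : HasDeg (qO k) (2 * k) :=
  ((hasDeg_neg_one_zpow k).mul (hasDeg_qint (by omega))).congr (by ring)

lemma hasDeg_qfact {k : ℤ} (hk : 0 ≤ k) : HasDeg (qfact k) (k * (k - 1)) := by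
  lift k to ℕ using hk
  rw [qfact, if_neg (by omega), Int.toNat_natCast]
  induction k with
  | zero => simpa using HasDeg.one
  | succ k ih =>
    rw [Finset.prod_range_succ]
    refine (ih.mul (hasDeg_qint (by omega))).congr ?_
    push_cast
    ring

lemma qfact_of_neg {k : ℤ} (hk : k < 0) : qfact k = 0 := if_pos hk

lemma hasDeg_qbinom {m k : ℤ} (hk : 0 ≤ k) (hm : k ≤ m) :
    HasDeg (qbinom m k) (2 * (k * (m - k))) :=
  ((hasDeg_qfact (hk.trans hm)).div
    ((hasDeg_qfact hk).mul (hasDeg_qfact (sub_nonneg.2 hm)))).congr (by ring)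

lemma qbinom_eq_zero {m k : ℤ} (h : k < 0 ∨ m < k) : qbinom m k = 0 := by
  rcases h with h | h
  · simp [qbinom, qfact_of_neg h]
  · simp [qbinom, qfact_of_neg (sub_neg.2 h)]

lemma qbinom_ne_zero_bounds {m k : ℤ} (h : qbinom m k ≠ 0) : 0 ≤ k ∧ k ≤ m := by
  by_contra hc
  exact h (qbinom_eq_zero (by omega))

lemma hasDeg_qtheta {a b c : ℤ} {x y z : ℤ} (ha : a = y + z) (hb : b = x + z) (hc : c = x + y)
    (hx : 0 ≤ x) (hy : 0 ≤ y) (hz : 0 ≤ z) :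
    HasDeg (qtheta a b c) (2 * (x + y + z) + 2 * (x * y + y * z + z * x)) := by
  have e : (a + b + c) / 2 = x + y + z := by omega
  have e1 : (-a + b + c) / 2 = x := by omega
  have e2 : (a - b + c) / 2 = y := by omega
  have e3 : (a + b - c) / 2 = z := by omega
  rw [qtheta, e, e1, e2, e3]
  exact ((hasDeg_qO (by omega)).mul ((hasDeg_qfact (by omega)).div
    (((hasDeg_qfact hx).mul (hasDeg_qfact hy)).mul (hasDeg_qfact hz)))).congr (by ring)

/-- The degree of the summand with index `z` of a normalized `6j`-symbol, in terms of
`x₁ = (-a+b+c)/2`, `p₁ = (a+β+γ)/2` and their analogues. -/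
def deltaDeg (x₁ x₂ x₃ p₁ p₂ p₃ z : ℤ) : ℤ :=
  2 * (1 + x₁ + x₂ + x₃) * (z - (x₁ + x₂ + x₃)) + 2 * ((z - p₁) * (x₁ - (z - p₁))) +
    2 * ((z - p₂) * (x₂ - (z - p₂))) + 2 * ((z - p₃) * (x₃ - (z - p₃)))

lemma deltaDeg_lt {x₁ x₂ x₃ p₁ p₂ p₃ z w : ℤ} (hzw : z < w)
    (h₁ : w ≤ x₁ + p₁) (h₂ : w ≤ x₂ + p₂) (h₃ : w ≤ x₃ + p₃) :
    deltaDeg x₁ x₂ x₃ p₁ p₂ p₃ z < deltaDeg x₁ x₂ x₃ p₁ p₂ p₃ w := by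
  have key : deltaDeg x₁ x₂ x₃ p₁ p₂ p₃ w - deltaDeg x₁ x₂ x₃ p₁ p₂ p₃ z =
      2 * ((w - z) * (1 + 3 * (w - z) +
        2 * ((x₁ + p₁ - w) + (x₂ + p₂ - w) + (x₃ + p₃ - w)))) := by
    unfold deltaDeg
    ring
  have : 0 < (w - z) * (1 + 3 * (w - z) +
      2 * ((x₁ + p₁ - w) + (x₂ + p₂ - w) + (x₃ + p₃ - w))) :=
    mul_pos (by omega) (by omega)
  omega

/-- The summand of `qdelta` with the largest admissible index determines the degree. -/
lemma hasDeg_qdelta {a b c α β γ x₁ x₂ x₃ p₁ p₂ p₃ w : ℤ}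
    (ha : a = x₂ + x₃) (hb : b = x₁ + x₃) (hc : c = x₁ + x₂)
    (hp₁ : a + β + γ = 2 * p₁) (hp₂ : α + b + γ = 2 * p₂) (hp₃ : α + β + c = 2 * p₃)
    (hσ : 0 ≤ x₁ + x₂ + x₃) (hw : x₁ + x₂ + x₃ ≤ w)
    (hw₁ : p₁ ≤ w) (hw₂ : p₂ ≤ w) (hw₃ : p₃ ≤ w)
    (h₁ : w ≤ x₁ + p₁) (h₂ : w ≤ x₂ + p₂) (h₃ : w ≤ x₃ + p₃)
    (hmax : w = x₁ + p₁ ∨ w = x₂ + p₂ ∨ w = x₃ + p₃) :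
    HasDeg (qdelta a b c α β γ) (deltaDeg x₁ x₂ x₃ p₁ p₂ p₃ w) := by
  have e : (a + b + c) / 2 = x₁ + x₂ + x₃ := by omega
  have e1 : (-a + b + c) / 2 = x₁ := by omega
  have e2 : (a - b + c) / 2 = x₂ := by omega
  have e3 : (a + b - c) / 2 = x₃ := by omega
  have e4 : (a + β + γ) / 2 = p₁ := by omega
  have e5 : (α + b + γ) / 2 = p₂ := by omega
  have e6 : (α + β + c) / 2 = p₃ := by omega
  rw [qdelta, e, e1, e2, e3, e4, e5, e6]
  set F : ℤ → RatFunc ℚ := fun z => (qO z / qO (x₁ + x₂ + x₃)) * qbinom z (x₁ + x₂ + x₃) *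
    qbinom x₁ (z - p₁) * qbinom x₂ (z - p₂) * qbinom x₃ (z - p₃) with hF
  have bounds : ∀ z, F z ≠ 0 → x₁ + x₂ + x₃ ≤ z ∧ (0 ≤ z - p₁ ∧ z - p₁ ≤ x₁) ∧
      (0 ≤ z - p₂ ∧ z - p₂ ≤ x₂) ∧ (0 ≤ z - p₃ ∧ z - p₃ ≤ x₃) := by
    intro z hz
    simp only [hF, mul_ne_zero_iff] at hz
    exact ⟨(qbinom_ne_zero_bounds hz.1.1.1.2).2, qbinom_ne_zero_bounds hz.1.1.2,
      qbinom_ne_zero_bounds hz.1.2, qbinom_ne_zero_bounds hz.2⟩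
  have deg : ∀ z, x₁ + x₂ + x₃ ≤ z → (0 ≤ z - p₁ ∧ z - p₁ ≤ x₁) →
      (0 ≤ z - p₂ ∧ z - p₂ ≤ x₂) → (0 ≤ z - p₃ ∧ z - p₃ ≤ x₃) →
      HasDeg (F z) (deltaDeg x₁ x₂ x₃ p₁ p₂ p₃ z) := by
    intro z hz hz₁ hz₂ hz₃
    refine ((((((hasDeg_qO (hσ.trans hz)).div (hasDeg_qO hσ)).mul (hasDeg_qbinom hσ hz)).mul
      (hasDeg_qbinom hz₁.1 hz₁.2)).mul (hasDeg_qbinom hz₂.1 hz₂.2)).mul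
      (hasDeg_qbinom hz₃.1 hz₃.2)).congr ?_
    unfold deltaDeg
    ring
  rw [finsum_eq_sum_of_support_subset (s := Finset.Icc (x₁ + x₂ + x₃) w) F]
  · refine HasDeg.sum (i := w) (Finset.mem_Icc.2 ⟨hw, le_rfl⟩)
      (deg w hw (by omega) (by omega) (by omega)) fun z hz hzw => ?_
    have hz' := Finset.mem_Icc.1 hz
    by_cases h0 : F z = 0
    · exact Or.inl h0
    obtain ⟨b₀, b₁, b₂, b₃⟩ := bounds z h0
    exact (deg z b₀ b₁ b₂ b₃).degLT (deltaDeg_lt (by omega) h₁ h₂ h₃)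
  · intro z hz
    have := bounds z hz
    simp only [Finset.coe_Icc, Set.mem_Icc]
    omega

lemma hasDeg_qf_zpow (a e : ℤ) : HasDeg (qf (2 * a) ^ e) (-(2 * a * (a + 1) * e)) := by
  have h : -(2 * a * (2 * a + 2)) / 2 = -(2 * a * (a + 1)) := by
    rw [show -(2 * a * (2 * a + 2)) = -(2 * a * (a + 1)) * 2 by ring]
    exact Int.mul_ediv_cancel _ two_ne_zero
  rw [qf, h]
  exact (((hasDeg_neg_one_zpow _).mul (hasDeg_V_zpow _)).zpow e).congr (by ring)

lemma hasDeg_qtheta_two_mul {n a : ℤ} (h0 : 0 ≤ a) (hn : a ≤ n) :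
    HasDeg (qtheta (2 * a) n n) (2 * (a + n) + 4 * a * n - 2 * a ^ 2) :=
  (hasDeg_qtheta (x := n - a) (y := a) (z := a) (by ring) (by ring) (by ring)
    (by omega) h0 h0).congr (by ring)

/-- The degree of `Δ(2a,2b,2c,n,n,n)`, where `m = max(a,b,c)`. -/
def delta₁Deg (n a b c m : ℤ) : ℤ :=
  2 * (a + b + c + 1) * (n - m) + 2 * ((b + c - m) * (m - a)) +
    2 * ((a + c - m) * (m - b)) + 2 * ((a + b - m) * (m - c))

/-- The degree of `Δ(2b,n,n,2d,n,n)`, where `w = min(n,b+d)`. -/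
def delta₂Deg (n b d w : ℤ) : ℤ :=
  2 * (b + n + 1) * (w - b) + 2 * ((w - b) * (n - w)) + 4 * ((w - d) * (b + d - w))

lemma hasDeg_delta₁ {n a b c d : ℤ} (h : inP n a b c d) :
    HasDeg (qdelta (2 * a) (2 * b) (2 * c) n n n) (delta₁Deg n a b c (max a (max b c))) := by
  obtain ⟨ha, ha', hb, hb', hc, hc', -, -, h₁, h₂⟩ := h
  have h₃ := abs_le.1 h₁
  refine (hasDeg_qdelta (x₁ := b + c - a) (x₂ := a + c - b) (x₃ := a + b - c)
    (p₁ := a + n) (p₂ := b + n) (p₃ := c + n) (w := n + a + b + c - max a (max b c))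
    (by ring) (by ring) (by ring) (by ring) (by ring) (by ring) ?_ ?_ ?_ ?_ ?_ ?_ ?_ ?_ ?_).congr
    ?_
  on_goal 10 => unfold deltaDeg delta₁Deg; ring
  all_goals omega

lemma hasDeg_delta₂ {n a b c d : ℤ} (h : inP n a b c d) :
    HasDeg (qdelta (2 * b) n n (2 * d) n n) (delta₂Deg n b d (min n (b + d))) := by
  obtain ⟨-, -, hb, hb', -, -, hd, hd', -, -⟩ := h
  refine (hasDeg_qdelta (x₁ := n - b) (x₂ := b) (x₃ := b)
    (p₁ := b + n) (p₂ := d + n) (p₃ := d + n) (w := n + min n (b + d))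
    (by ring) (by ring) (by ring) (by ring) (by ring) (by ring) ?_ ?_ ?_ ?_ ?_ ?_ ?_ ?_ ?_).congr
    ?_
  on_goal 10 => unfold deltaDeg delta₂Deg; ring
  all_goals omega

/-- The degree of the summand `T`. -/
def summandDeg (r s t u n a b c d : ℤ) : ℤ :=
  2 * delta₁Deg n a b c (max a (max b c)) + delta₂Deg n b d (min n (b + d)) +
    4 * (a + b + c + d) -
    2 * (a * (a + 1) * r + b * (b + 1) * s + c * (c + 1) * t - d * (d + 1) * u) +
    (2 * (a + b + c) + 4 * (a * b + b * c + c * a) - 2 * (a ^ 2 + b ^ 2 + c ^ 2)) -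
    (2 * (a + b + c + d + 4 * n) + 4 * n * (a + b + c + d) -
      2 * (a ^ 2 + b ^ 2 + c ^ 2 + d ^ 2))

lemma hasDeg_T {r s t u n a b c d : ℤ} (h : inP n a b c d) :
    HasDeg (T r s t u n a b c d) (summandDeg r s t u n a b c d) := by
  have hΔ₁ := hasDeg_delta₁ h
  have hΔ₂ := hasDeg_delta₂ h
  obtain ⟨ha, ha', hb, hb', hc, hc', hd, hd', h₁, h₂⟩ := h
  have h₃ := abs_le.1 h₁
  have hθ : HasDeg (qtheta (2 * a) (2 * b) (2 * c)) _ :=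
    hasDeg_qtheta (x := b + c - a) (y := a + c - b) (z := a + b - c)
      (by ring) (by ring) (by ring) (by omega) (by omega) (by omega)
  have hO {e : ℤ} (he : 0 ≤ e) : HasDeg (qO (2 * e)) (2 * (2 * e)) := hasDeg_qO (by omega)
  refine (((((((((((hΔ₁.pow 2).mul hΔ₂).mul (hO ha)).mul (hO hb)).mul (hO hc)).mul (hO hd)).mul
    (hasDeg_qf_zpow a r)).mul (hasDeg_qf_zpow b s)).mul (hasDeg_qf_zpow c t)).mul
    (hasDeg_qf_zpow d (-u))).mul hθ |>.div
    ((((hasDeg_qtheta_two_mul ha ha').mul (hasDeg_qtheta_two_mul hb hb')).mul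
      (hasDeg_qtheta_two_mul hc hc')).mul (hasDeg_qtheta_two_mul hd hd'))).congr ?_
  unfold summandDeg
  push_cast
  ring

lemma summandDeg_swap (r s t u n a b c d : ℤ) :
    summandDeg r s t u n a b c d = summandDeg t s r u n c b a d := by
  unfold summandDeg delta₁Deg
  rw [show max c (max b a) = max a (max b c) by omega]
  ring

lemma delta₁Deg_succ_max_of_lt {n a b c : ℤ} (h : a < max b c) (h₁ : |a - b| ≤ c)
    (h₂ : c ≤ a + b) :
    delta₁Deg n (a + 1) b c (max (a + 1) (max b c)) -
      delta₁Deg n a b c (max a (max b c)) ≤ 2 * n + 2 * a - 2 * b - 2 * c := by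
  have h₃ := abs_le.1 h₁
  rw [max_eq_right (by omega : a + 1 ≤ max b c), max_eq_right h.le]
  rcases le_total b c with hbc | hbc
  · rw [max_eq_right hbc]
    unfold delta₁Deg
    linarith
  · rw [max_eq_left hbc]
    unfold delta₁Deg
    linarith

lemma delta₁Deg_succ_max_of_ge {n a b c : ℤ} (h : max b c ≤ a) :
    delta₁Deg n (a + 1) b c (max (a + 1) (max b c)) -
      delta₁Deg n a b c (max a (max b c)) = 2 * n - 4 * a - 4 := by
  rw [max_eq_left (by omega : max b c ≤ a + 1), max_eq_left h]
  unfold delta₁Deg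
  ring

lemma summandDeg_succ_left {r s t u n a b c d : ℤ} (hr : 3 ≤ r) (h : inP n a b c d) :
    summandDeg r s t u n (a + 1) b c d < summandDeg r s t u n a b c d := by
  obtain ⟨ha, -, hb, -, hc, -, -, -, h₁, h₂⟩ := h
  have hdiff : summandDeg r s t u n (a + 1) b c d - summandDeg r s t u n a b c d =
      2 * (delta₁Deg n (a + 1) b c (max (a + 1) (max b c)) -
        delta₁Deg n a b c (max a (max b c))) -
      4 * ((a + 1) * r) + 4 + 4 * b + 4 * c - 4 * n := by
    unfold summandDeg
    ring
  have har : (a + 1) * 3 ≤ (a + 1) * r := mul_le_mul_of_nonneg_left hr (by omega)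
  rcases lt_or_ge a (max b c) with hlt | hge
  · have := delta₁Deg_succ_max_of_lt (n := n) hlt h₁ h₂
    omega
  · have := delta₁Deg_succ_max_of_ge (n := n) hge
    omega

lemma delta₂Deg_sub_pred_le (n b d : ℤ) :
    delta₂Deg n b d (min n (b + d)) - delta₂Deg n b (d - 1) (min n (b + (d - 1))) ≤
      4 * (n - d + 1) := by
  rcases le_or_gt (b + d) n with h | h
  · rw [min_eq_right h, min_eq_right (by omega)]
    unfold delta₂Deg
    linarith
  · rw [min_eq_left h.le, min_eq_left (by omega)]
    unfold delta₂Deg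
    linarith

lemma summandDeg_lt_pred_right {r s t u n a b c d : ℤ} (hu : u ≤ -3) (hd : 1 ≤ d) :
    summandDeg r s t u n a b c d < summandDeg r s t u n a b c (d - 1) := by
  have hdiff : summandDeg r s t u n a b c d - summandDeg r s t u n a b c (d - 1) =
      delta₂Deg n b d (min n (b + d)) - delta₂Deg n b (d - 1) (min n (b + (d - 1))) +
      4 * (d * u) + 4 * d - 4 * n := by
    unfold summandDeg
    ring
  have hdu : d * u ≤ d * -3 := mul_le_mul_of_nonneg_left hu (by omega)
  have := delta₂Deg_sub_pred_le n b d
  omega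

end CJP

open CJP in
/-- For odd integers `r,t ≥ 3`, `s ≤ -3`, `u ≤ -3` and `n ≥ 1`, the
`v`-degree `δ` of the (nonzero) summands of the state sum satisfies
`δ(a+1,b,c,d) < δ(a,b,c,d)`, `δ(a,b,c+1,d) < δ(a,b,c,d)` and
`δ(a,b,c,d) < δ(a,b,c,d-1)` whenever both lattice points lie in `nP ∩ ℤ⁴`. -/
theorem summand_degree_monotone (r s t u n : ℤ)
    (hrodd : Odd r) (hsodd : Odd s) (htodd : Odd t) (huodd : Odd u)
    (hr : 3 ≤ r) (ht : 3 ≤ t) (hs : s ≤ -3) (hu : u ≤ -3) (hn : 1 ≤ n)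
    (a b c d : ℤ) :
    (inP n (a + 1) b c d → inP n a b c d →
      T r s t u n (a + 1) b c d ≠ 0 → T r s t u n a b c d ≠ 0 →
      (T r s t u n (a + 1) b c d).intDegree < (T r s t u n a b c d).intDegree) ∧
    (inP n a b (c + 1) d → inP n a b c d →
      T r s t u n a b (c + 1) d ≠ 0 → T r s t u n a b c d ≠ 0 →
      (T r s t u n a b (c + 1) d).intDegree < (T r s t u n a b c d).intDegree) ∧
    (inP n a b c d → inP n a b c (d - 1) →
      T r s t u n a b c d ≠ 0 → T r s t u n a b c (d - 1) ≠ 0 →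
      (T r s t u n a b c d).intDegree < (T r s t u n a b c (d - 1)).intDegree) := by
  refine ⟨fun h' h _ _ => ?_, fun h' h _ _ => ?_, fun h h' _ _ => ?_⟩
  · rw [(hasDeg_T h').2, (hasDeg_T h).2]
    exact summandDeg_succ_left hr h
  · rw [(hasDeg_T h').2, (hasDeg_T h).2, summandDeg_swap, summandDeg_swap r]
    obtain ⟨ha, ha', hb, hb', hc, hc', hd, hd', h₁, h₂⟩ := h
    have h₃ := abs_le.1 h₁
    exact summandDeg_succ_left ht
      ⟨hc, hc', hb, hb', ha, ha', hd, hd', abs_le.2 (by omega), by omega⟩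
  · rw [(hasDeg_T h).2, (hasDeg_T h').2]
    obtain ⟨-, -, -, -, -, -, hd, -⟩ := h'
    exact summandDeg_lt_pred_right hu (by omega)
end
end
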